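/- Consider a pure jump Markov process on ℝ^d with data (λ,k,P₀), λ̄:=sup_x λ(x)<∞, and define Q₀=P₀ and Q_n(dx_n)=∫ Q_{n−1}(dx_{n−1}) λ(x_{n−1}) k(x_{n−1},dx_n) for n≥1. Then: (a) for every n≥0 and t≥0, as measures, e^{−λ̄t} (tⁿ/n!) Q_n(dx) ≤ P_{n,t}(dx) ≤ (tⁿ/n!) Q_n(dx); (b) for every measurable f:ℝ^d→ℝ̄, every t>0 and every η>0, ∫∫ λ(x)|f(y)| k(x,dy) P_t(dx) ≤ C_η(t) ( (Σ_{n≥1} ∫|f(x)|^{1+η} P_{n,t}(dx)) / t )^{1/(1+η)}, where C_η(t) = e^{λ̄t} ( ( e^{λ̄t(e^{(1+η)/(eη)}−1)} − e^{−λ̄t} ) / t )^{η/(1+η)}. -/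

import Mathlib

open MeasureTheory ProbabilityTheory
open scoped ENNReal

/-- The measure `P_{n,t}` of the pure jump Markov process, defined recursively over the
last jump time. -/
noncomputable def jumpMarginalN {E : Type*} [MeasurableSpace E]
    (l : E → ℝ) (k : Kernel E E) (P0 : Measure E) : ℕ → ℝ → Measure E
  | 0, t => P0.withDensity fun x => ENNReal.ofReal (Real.exp (-(l x) * t))
  | n + 1, t =>
      (volume.restrict (Set.Icc (0:ℝ) t)).bind fun s =>
        ((jumpMarginalN l k P0 n s).withDensity fun x => ENNReal.ofReal (l x)).bind
          fun x => (k x).withDensity fun y => ENNReal.ofReal (Real.exp (-(l y) * (t - s)))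

/-- The time-`t` marginal `P_t = Σ_n P_{n,t}`. -/
noncomputable def jumpMarginal {E : Type*} [MeasurableSpace E]
    (l : E → ℝ) (k : Kernel E E) (P0 : Measure E) (t : ℝ) : Measure E :=
  Measure.sum fun n => jumpMarginalN l k P0 n t

/-- The measures `Q_n`: `Q_0 = P_0` and `Q_{n+1}(dy) = ∫ Q_n(dx) λ(x) k(x,dy)`. -/
noncomputable def jumpQ {E : Type*} [MeasurableSpace E]
    (l : E → ℝ) (k : Kernel E E) (P0 : Measure E) : ℕ → Measure E
  | 0 => P0
  | n + 1 => ((jumpQ l k P0 n).withDensity fun x => ENNReal.ofReal (l x)).bind fun x => k x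

section Jump

variable {E : Type*} [MeasurableSpace E] {l : E → ℝ} {k : Kernel E E} {P0 : Measure E}

theorem lintegral_bind_withDensity [IsSFiniteKernel k] (hl : Measurable l) (μ : Measure E)
    {w f : E → ℝ≥0∞} (hw : Measurable w) (hf : Measurable f) :
    ∫⁻ y, f y ∂((μ.withDensity fun x => ENNReal.ofReal (l x)).bind fun x => (k x).withDensity w)
      = ∫⁻ x, ENNReal.ofReal (l x) * ∫⁻ y, w y * f y ∂(k x) ∂μ := by
  have hwu : Measurable (Function.uncurry fun (_ : E) => w) := hw.comp measurable_snd
  have hker : (fun x => (k x).withDensity w) = ⇑(k.withDensity fun _ => w) := by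
    ext1 x
    rw [Kernel.withDensity_apply _ hwu]
  rw [hker, Measure.lintegral_bind (Kernel.measurable _).aemeasurable hf.aemeasurable]
  simp_rw [Kernel.lintegral_withDensity k hwu _ hf]
  exact lintegral_withDensity_eq_lintegral_mul _ hl.ennreal_ofReal
    (Measurable.lintegral_kernel (hw.mul hf))

theorem lintegral_jumpQ_succ [IsSFiniteKernel k] (hl : Measurable l) (n : ℕ)
    {f : E → ℝ≥0∞} (hf : Measurable f) :
    ∫⁻ y, f y ∂(jumpQ l k P0 (n + 1))
      = ∫⁻ x, ENNReal.ofReal (l x) * ∫⁻ y, f y ∂(k x) ∂(jumpQ l k P0 n) := by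
  simpa [jumpQ, withDensity_one] using
    lintegral_bind_withDensity (k := k) hl (jumpQ l k P0 n) (w := 1) measurable_one hf

theorem lintegral_jumpMarginalN_succ_of_kernel [IsSFiniteKernel k] (hl : Measurable l) (n : ℕ)
    (κ : Kernel ℝ E) [IsSFiniteKernel κ] (hκ : ∀ t, κ t = jumpMarginalN l k P0 n t)
    (t : ℝ) {f : E → ℝ≥0∞} (hf : Measurable f) :
    ∫⁻ y, f y ∂(jumpMarginalN l k P0 (n + 1) t)
      = ∫⁻ s in Set.Icc 0 t, ∫⁻ x, ENNReal.ofReal (l x) *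
          ∫⁻ y, ENNReal.ofReal (Real.exp (-(l y) * (t - s))) * f y ∂(k x)
        ∂(jumpMarginalN l k P0 n s) := by
  have step (s : ℝ) {g : E → ℝ≥0∞} (hg : Measurable g) :=
    lintegral_bind_withDensity (k := k) hl (jumpMarginalN l k P0 n s)
      (w := fun y => ENNReal.ofReal (Real.exp (-(l y) * (t - s)))) (by fun_prop) hg
  rw [jumpMarginalN, Measure.lintegral_bind _ hf.aemeasurable]
  · simp_rw [step _ hf]
  · refine (Measure.measurable_of_measurable_coe _ fun A hA => ?_).aemeasurable
    have hA1 : Measurable (A.indicator (1 : E → ℝ≥0∞)) := measurable_one.indicator hA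
    simp_rw [← lintegral_indicator_one hA, step _ hA1, ← hκ]
    refine Measurable.lintegral_kernel_prod_right' (κ := κ) (f := fun p : ℝ × E =>
      ENNReal.ofReal (l p.2) * ∫⁻ y, ENNReal.ofReal (Real.exp (-(l y) * (t - p.1))) *
        A.indicator 1 y ∂(k p.2)) ?_
    refine (hl.comp measurable_snd).ennreal_ofReal.mul ?_
    refine Measurable.lintegral_kernel_prod_right' (κ := k.prodMkLeft ℝ)
      (f := fun p : (ℝ × E) × E =>
        ENNReal.ofReal (Real.exp (-(l p.2) * (t - p.1.1))) * A.indicator 1 p.2) ?_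
    exact Measurable.mul (by fun_prop) (hA1.comp measurable_snd)

/-- The marginals `P_{n,t}` form an s-finite kernel in the time variable. -/
theorem exists_kernel_jumpMarginalN [IsSFiniteKernel k] [SFinite P0] (hl : Measurable l) (n : ℕ) :
    ∃ κ : Kernel ℝ E, IsSFiniteKernel κ ∧ ∀ t, κ t = jumpMarginalN l k P0 n t := by
  induction n with
  | zero =>
    refine ⟨(Kernel.const ℝ P0).withDensity
      fun t x => ((Real.exp (-(l x) * t)).toNNReal : ℝ≥0∞), inferInstance, fun t => ?_⟩
    rw [Kernel.withDensity_apply _ (by fun_prop), Kernel.const_apply]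
    rfl
  | succ n ih =>
    obtain ⟨κ, hsf, hκ⟩ := ih
    set w : ℝ → (ℝ × E) × E → NNReal := fun t p =>
      (Set.Icc 0 t).indicator 1 p.1.1 * (l p.1.2).toNNReal *
        (Real.exp (-(l p.2) * (t - p.1.1))).toNNReal with hw
    have hwm : Measurable (Function.uncurry fun t p => (w t p : ℝ≥0∞)) := by
      have hind : Measurable fun q : ℝ × (ℝ × E) × E =>
          (Set.Icc 0 q.1).indicator (1 : ℝ → NNReal) q.2.1.1 := by
        have hS : MeasurableSet {q : ℝ × (ℝ × E) × E | 0 ≤ q.2.1.1 ∧ q.2.1.1 ≤ q.1} := by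
          measurability
        exact (measurable_one (α := NNReal)).indicator hS
      exact ((hind.mul (by fun_prop)).mul (by fun_prop)).coe_nnreal_ennreal
    set κ₀ : Kernel ℝ ((ℝ × E) × E) :=
      (Kernel.const ℝ (volume : Measure ℝ) ⊗ₖ κ.prodMkLeft ℝ) ⊗ₖ
        ((k.prodMkLeft ℝ).prodMkLeft ℝ) with hκ₀
    refine ⟨(κ₀.withDensity fun t p => (w t p : ℝ≥0∞)).snd, inferInstance, fun t => ?_⟩
    refine Measure.ext_of_lintegral _ fun f hf => ?_
    have hwt : Measurable fun p => (w t p : ℝ≥0∞) := hwm.comp measurable_prodMk_left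
    have hf2 : Measurable fun p : (ℝ × E) × E => f p.2 := hf.comp measurable_snd
    have hwf : Measurable fun p : (ℝ × E) × E => (w t p : ℝ≥0∞) * f p.2 := hwt.mul hf2
    have hin : Measurable fun p : ℝ × E => ∫⁻ y, (w t (p, y) : ℝ≥0∞) * f y ∂(k p.2) :=
      Measurable.lintegral_kernel_prod_right' (κ := k.prodMkLeft ℝ) hwf
    rw [lintegral_jumpMarginalN_succ_of_kernel hl n κ hκ t hf, Kernel.lintegral_snd _ _ hf,
      Kernel.lintegral_withDensity _ hwm _ hf2, hκ₀,
      Kernel.lintegral_compProd _ _ _ hwf]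
    simp only [Kernel.prodMkLeft_apply]
    rw [Kernel.lintegral_compProd _ _ _ hin, ← lintegral_indicator measurableSet_Icc]
    simp only [Kernel.const_apply, Kernel.prodMkLeft_apply]
    refine lintegral_congr fun s => ?_
    by_cases hs : s ∈ Set.Icc 0 t
    · simp only [Set.indicator_of_mem hs, hκ, hw, Pi.one_apply, one_mul, ENNReal.coe_mul]
      refine lintegral_congr fun x => ?_
      rw [← lintegral_const_mul _ (by fun_prop)]
      simp only [mul_assoc]
      rfl
    · simp [Set.indicator_of_notMem hs, hw]

theorem lintegral_jumpMarginalN_succ [IsSFiniteKernel k] [SFinite P0] (hl : Measurable l) (n : ℕ)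
    (t : ℝ) {f : E → ℝ≥0∞} (hf : Measurable f) :
    ∫⁻ y, f y ∂(jumpMarginalN l k P0 (n + 1) t)
      = ∫⁻ s in Set.Icc 0 t, ∫⁻ x, ENNReal.ofReal (l x) *
          ∫⁻ y, ENNReal.ofReal (Real.exp (-(l y) * (t - s))) * f y ∂(k x)
        ∂(jumpMarginalN l k P0 n s) := by
  obtain ⟨κ, _, hκ⟩ := exists_kernel_jumpMarginalN (k := k) (P0 := P0) hl n
  exact lintegral_jumpMarginalN_succ_of_kernel hl n κ hκ t hf

theorem lintegral_Icc_pow_div_factorial (n : ℕ) {t : ℝ} (ht : 0 ≤ t) :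
    ∫⁻ s in Set.Icc 0 t, ENNReal.ofReal (s ^ n / n.factorial)
      = ENNReal.ofReal (t ^ (n + 1) / (n + 1).factorial) := by
  have hcont : Continuous fun s : ℝ => s ^ n / (n.factorial : ℝ) := by fun_prop
  rw [← ofReal_integral_eq_lintegral_ofReal (hcont.integrableOn_Icc)
    ((ae_restrict_mem measurableSet_Icc).mono fun s hs =>
      div_nonneg (pow_nonneg hs.1 n) (Nat.cast_nonneg _)),
    integral_Icc_eq_integral_Ioc, ← intervalIntegral.integral_of_le ht,
    intervalIntegral.integral_div, integral_pow]
  congr 1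
  rw [Nat.factorial_succ]
  push_cast
  field_simp
  simp

theorem jumpMarginalN_le [IsSFiniteKernel k] [SFinite P0] (hl : Measurable l) (hl0 : ∀ x, 0 ≤ l x)
    (n : ℕ) {t : ℝ} (ht : 0 ≤ t) :
    jumpMarginalN l k P0 n t ≤ ENNReal.ofReal (t ^ n / n.factorial) • jumpQ l k P0 n := by
  induction n generalizing t with
  | zero =>
    refine Measure.le_iff.2 fun A hA => ?_
    simp only [jumpMarginalN, jumpQ, pow_zero, Nat.factorial_zero, Nat.cast_one, div_one,
      ENNReal.ofReal_one, one_smul]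
    rw [withDensity_apply _ hA, ← setLIntegral_one]
    refine lintegral_mono fun x => ENNReal.ofReal_le_one.2 (Real.exp_le_one_iff.2 ?_)
    nlinarith [mul_nonneg (hl0 x) ht]
  | succ n ih =>
    refine Measure.le_iff.2 fun A hA => ?_
    have hA1 : Measurable (A.indicator (1 : E → ℝ≥0∞)) := measurable_one.indicator hA
    rw [Measure.smul_apply, ← lintegral_indicator_one hA, ← lintegral_indicator_one hA,
      lintegral_jumpMarginalN_succ hl n t hA1, lintegral_jumpQ_succ hl n hA1, smul_eq_mul,
      ← lintegral_Icc_pow_div_factorial n ht, ← lintegral_mul_const _ (by fun_prop)]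
    refine setLIntegral_mono_ae' measurableSet_Icc (ae_of_all _ fun s hs => ?_)
    rw [← smul_eq_mul, ← lintegral_smul_measure]
    refine lintegral_mono' (ih hs.1) fun x => ?_
    gcongr with y
    refine mul_le_of_le_one_left' (ENNReal.ofReal_le_one.2 (Real.exp_le_one_iff.2 ?_))
    nlinarith [mul_nonneg (hl0 y) (sub_nonneg.2 hs.2)]

theorem le_jumpMarginalN [IsSFiniteKernel k] [SFinite P0] (hl : Measurable l) {lbar : ℝ}
    (hlbar : ∀ x, l x ≤ lbar) (n : ℕ) {t : ℝ} (ht : 0 ≤ t) :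
    ENNReal.ofReal (Real.exp (-lbar * t) * t ^ n / n.factorial) • jumpQ l k P0 n
      ≤ jumpMarginalN l k P0 n t := by
  induction n generalizing t with
  | zero =>
    refine Measure.le_iff.2 fun A hA => ?_
    simp only [jumpMarginalN, jumpQ, pow_zero, Nat.factorial_zero, Nat.cast_one, div_one, mul_one]
    rw [withDensity_apply _ hA, Measure.smul_apply, smul_eq_mul, ← setLIntegral_const]
    refine lintegral_mono fun x => ENNReal.ofReal_le_ofReal (Real.exp_le_exp.2 ?_)
    nlinarith [mul_nonneg (sub_nonneg.2 (hlbar x)) ht]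
  | succ n ih =>
    refine Measure.le_iff.2 fun A hA => ?_
    have hA1 : Measurable (A.indicator (1 : E → ℝ≥0∞)) := measurable_one.indicator hA
    rw [Measure.smul_apply, ← lintegral_indicator_one hA, ← lintegral_indicator_one hA,
      lintegral_jumpMarginalN_succ hl n t hA1, lintegral_jumpQ_succ hl n hA1, smul_eq_mul]
    obtain ⟨I, hI⟩ : ∃ I, I = ∫⁻ x, ENNReal.ofReal (l x) * ∫⁻ y, A.indicator 1 y ∂(k x)
      ∂(jumpQ l k P0 n) := ⟨_, rfl⟩
    rw [← hI, mul_div_assoc, ENNReal.ofReal_mul (Real.exp_nonneg _),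
      ← lintegral_Icc_pow_div_factorial n ht, ← lintegral_const_mul _ (by fun_prop),
      ← lintegral_mul_const _ (by fun_prop)]
    have hlk : Measurable fun x => ENNReal.ofReal (l x) * ∫⁻ y, A.indicator 1 y ∂(k x) :=
      hl.ennreal_ofReal.mul (Measurable.lintegral_kernel hA1)
    refine setLIntegral_mono_ae' measurableSet_Icc (ae_of_all _ fun s hs => ?_)
    have hexp : ENNReal.ofReal (Real.exp (-lbar * t)) * ENNReal.ofReal (s ^ n / n.factorial)
        = ENNReal.ofReal (Real.exp (-lbar * (t - s)))
          * ENNReal.ofReal (Real.exp (-lbar * s) * s ^ n / n.factorial) := by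
      rw [← ENNReal.ofReal_mul (Real.exp_nonneg _), ← ENNReal.ofReal_mul (Real.exp_nonneg _),
        mul_div_assoc, ← mul_assoc, ← Real.exp_add]
      ring_nf
    rw [hexp, mul_assoc, hI, ← smul_eq_mul (a := ENNReal.ofReal (_ / _)),
      ← lintegral_smul_measure, ← lintegral_const_mul _ hlk]
    refine lintegral_mono' (ih hs.1) fun x => ?_
    rw [mul_left_comm, ← lintegral_const_mul _ hA1]
    gcongr with y
    · exact sub_nonneg.2 hs.2
    · exact hlbar y

theorem jumpQ_univ_le [IsMarkovKernel k] [IsProbabilityMeasure P0] (hl : Measurable l) {lbar : ℝ}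
    (hlbar : ∀ x, l x ≤ lbar) (n : ℕ) :
    jumpQ l k P0 n Set.univ ≤ ENNReal.ofReal lbar ^ n := by
  induction n with
  | zero => simp [jumpQ]
  | succ n ih =>
    rw [← lintegral_one, lintegral_jumpQ_succ hl n measurable_const]
    simp only [lintegral_one, measure_univ, mul_one]
    calc ∫⁻ x, ENNReal.ofReal (l x) ∂(jumpQ l k P0 n)
        ≤ ∫⁻ _, ENNReal.ofReal lbar ∂(jumpQ l k P0 n) :=
          lintegral_mono fun x => ENNReal.ofReal_le_ofReal (hlbar x)
      _ ≤ ENNReal.ofReal lbar ^ (n + 1) := by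
          rw [lintegral_const, pow_succ']
          gcongr

theorem lintegral_jumpMarginal_le [IsSFiniteKernel k] [SFinite P0] (hl : Measurable l)
    (hl0 : ∀ x, 0 ≤ l x) {t : ℝ} (ht : 0 ≤ t) {g : E → ℝ≥0∞} (hg : Measurable g) :
    ∫⁻ x, ENNReal.ofReal (l x) * ∫⁻ y, g y ∂(k x) ∂(jumpMarginal l k P0 t)
      ≤ ∑' n : ℕ, ENNReal.ofReal (t ^ n / n.factorial) * ∫⁻ y, g y ∂(jumpQ l k P0 (n + 1)) := by
  rw [jumpMarginal, lintegral_sum_measure]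
  refine ENNReal.tsum_le_tsum fun n => ?_
  rw [lintegral_jumpQ_succ hl n hg, ← smul_eq_mul (a := ENNReal.ofReal (_ / _)),
    ← lintegral_smul_measure]
  exact lintegral_mono' (jumpMarginalN_le hl hl0 n ht) le_rfl

end Jump

/-- Hölder's inequality for the measure `∑ₙ δₙ ⊗ νₙ`, one factor depending on `n` only. -/
theorem tsum_mul_lintegral_le_Lp_mul_Lq {E : Type*} [MeasurableSpace E] (ν : ℕ → Measure E)
    {p q : ℝ} (hpq : p.HolderConjugate q) (c : ℕ → ℝ≥0∞) {g : E → ℝ≥0∞} (hg : Measurable g) :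
    ∑' n, c n * ∫⁻ x, g x ∂(ν n)
      ≤ (∑' n, ∫⁻ x, g x ^ p ∂(ν n)) ^ (1 / p) * (∑' n, c n ^ q * ν n Set.univ) ^ (1 / q) := by
  set μ : Measure (ℕ × E) := Measure.sum fun n => (ν n).map (Prod.mk n) with hμ
  have hint {F : ℕ × E → ℝ≥0∞} (hF : Measurable F) :
      ∫⁻ z, F z ∂μ = ∑' n, ∫⁻ x, F (n, x) ∂(ν n) := by
    rw [hμ, lintegral_sum_measure]
    simp_rw [lintegral_map hF measurable_prodMk_left]
  have hc : Measurable fun z : ℕ × E => c z.1 := (measurable_of_countable c).comp measurable_fst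
  have hg2 : Measurable fun z : ℕ × E => g z.2 := hg.comp measurable_snd
  have holder := ENNReal.lintegral_mul_le_Lp_mul_Lq μ hpq hg2.aemeasurable hc.aemeasurable
  rw [hint (hg2.mul hc), hint (hg2.pow_const p), hint (hc.pow_const q)] at holder
  simpa [lintegral_mul_const _ hg, mul_comm (c _)] using holder

theorem rpow_le_exp_pow {q : ℝ} (hq : 0 ≤ q) (n : ℕ) :
    (n : ℝ) ^ q ≤ Real.exp (q / Real.exp 1) ^ n := by
  have hn : (n : ℝ) ≤ Real.exp (n / Real.exp 1) := by
    have h := Real.add_one_le_exp (n / Real.exp 1 - 1)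
    rwa [sub_add_cancel, Real.exp_sub, div_le_div_iff_of_pos_right (Real.exp_pos 1)] at h
  calc (n : ℝ) ^ q ≤ Real.exp (n / Real.exp 1) ^ q := by gcongr
    _ = Real.exp (q / Real.exp 1) ^ n := by
      rw [← Real.exp_mul, ← Real.exp_nat_mul]
      ring_nf

theorem tsum_pow_succ_div_factorial {x : ℝ} (hx : 0 ≤ x) :
    ∑' n : ℕ, ENNReal.ofReal (x ^ (n + 1) / (n + 1).factorial)
      = ENNReal.ofReal (Real.exp x - 1) := by
  have h : HasSum (fun n : ℕ => x ^ (n + 1) / ((n + 1).factorial : ℝ)) (Real.exp x - 1) := by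
    have h0 := NormedSpace.expSeries_div_hasSum_exp x
    rw [← Real.exp_eq_exp_ℝ] at h0
    simpa using (hasSum_nat_add_iff' 1).2 h0
  rw [← h.tsum_eq, ENNReal.ofReal_tsum_of_nonneg (fun n => by positivity) h.summable]

theorem inv_mul_rpow_mul_rpow (a s d T : ℝ≥0∞) {x y : ℝ} (hx : 0 ≤ x) (hy : 0 ≤ y)
    (hxy : x + y = 1) :
    T⁻¹ * ((a * s) ^ x * (a * d) ^ y) = a * (d / T) ^ y * (s / T) ^ x := by
  have split (b : ℝ≥0∞) : b = b ^ x * b ^ y := by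
    rw [← ENNReal.rpow_add_of_nonneg _ _ hx hy, hxy, ENNReal.rpow_one]
  rw [div_eq_mul_inv, div_eq_mul_inv]
  simp only [ENNReal.mul_rpow_of_nonneg _ _ hx, ENNReal.mul_rpow_of_nonneg _ _ hy]
  conv_lhs => rw [split T⁻¹]
  conv_rhs => rw [split a]
  ring

theorem tsum_lintegral_jumpQ_rpow_le {E : Type*} [MeasurableSpace E] {l : E → ℝ} {k : Kernel E E}
    {P0 : Measure E} [IsSFiniteKernel k] [SFinite P0] (hl : Measurable l) {lbar : ℝ}
    (hlbar : ∀ x, l x ≤ lbar) {t : ℝ} (ht : 0 ≤ t) (g : E → ℝ≥0∞) :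
    ∑' n : ℕ, ∫⁻ x, g x ∂(ENNReal.ofReal (t ^ (n + 1) / (n + 1).factorial) • jumpQ l k P0 (n + 1))
      ≤ ENNReal.ofReal (Real.exp (lbar * t)) *
          ∑' n : ℕ, ∫⁻ x, g x ∂(jumpMarginalN l k P0 (n + 1) t) := by
  rw [← ENNReal.tsum_mul_left]
  refine ENNReal.tsum_le_tsum fun n => ?_
  rw [← smul_eq_mul (a := ENNReal.ofReal _), ← lintegral_smul_measure]
  refine lintegral_mono' ?_ le_rfl
  have h := le_jumpMarginalN (k := k) (P0 := P0) hl hlbar (n + 1) ht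
  calc ENNReal.ofReal (t ^ (n + 1) / (n + 1).factorial) • jumpQ l k P0 (n + 1)
      = ENNReal.ofReal (Real.exp (lbar * t)) •
          ENNReal.ofReal (Real.exp (-lbar * t) * t ^ (n + 1) / (n + 1).factorial) •
            jumpQ l k P0 (n + 1) := by
        rw [smul_smul, ← ENNReal.ofReal_mul (Real.exp_nonneg _), mul_div_assoc, ← mul_assoc,
          ← Real.exp_add]
        simp
    _ ≤ _ := by gcongr

theorem tsum_rpow_mul_jumpQ_univ_le {E : Type*} [MeasurableSpace E] {l : E → ℝ} {k : Kernel E E}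
    {P0 : Measure E} [IsMarkovKernel k] [IsProbabilityMeasure P0] (hl : Measurable l) {lbar : ℝ}
    (hlbar0 : 0 ≤ lbar) (hlbar : ∀ x, l x ≤ lbar) {t : ℝ} (ht : 0 ≤ t) {q : ℝ} (hq : 0 ≤ q) :
    ∑' n : ℕ, ((n + 1 : ℕ) : ℝ≥0∞) ^ q *
        (ENNReal.ofReal (t ^ (n + 1) / (n + 1).factorial) • jumpQ l k P0 (n + 1)) Set.univ
      ≤ ENNReal.ofReal (Real.exp (lbar * t * Real.exp (q / Real.exp 1)) - 1) := by
  rw [← tsum_pow_succ_div_factorial (by positivity)]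
  refine ENNReal.tsum_le_tsum fun n => ?_
  rw [Measure.smul_apply, smul_eq_mul]
  calc ((n + 1 : ℕ) : ℝ≥0∞) ^ q *
        (ENNReal.ofReal (t ^ (n + 1) / (n + 1).factorial) * jumpQ l k P0 (n + 1) Set.univ)
      ≤ ENNReal.ofReal (Real.exp (q / Real.exp 1) ^ (n + 1)) *
          (ENNReal.ofReal (t ^ (n + 1) / (n + 1).factorial) * ENNReal.ofReal lbar ^ (n + 1)) := by
        gcongr
        · rw [← ENNReal.ofReal_natCast, ENNReal.ofReal_rpow_of_nonneg (Nat.cast_nonneg _) hq]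
          exact ENNReal.ofReal_le_ofReal (rpow_le_exp_pow hq _)
        · exact jumpQ_univ_le hl hlbar _
    _ = _ := by
        rw [← ENNReal.ofReal_pow hlbar0, ← ENNReal.ofReal_mul (by positivity),
          ← ENNReal.ofReal_mul (by positivity)]
        congr 1
        rw [mul_pow, mul_pow]
        ring
/-- (a) `e^{-λ̄t} (tⁿ/n!) Q_n ≤ P_{n,t} ≤ (tⁿ/n!) Q_n` as measures;
(b) `∫∫ λ(x)|f(y)| k(x,dy) P_t(dx) ≤ C_η(t) ((Σ_{n≥1} ∫|f|^{1+η} dP_{n,t}) / t)^{1/(1+η)}`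
with `C_η(t) = e^{λ̄t} ((e^{λ̄t(e^{(1+η)/(eη)}-1)} - e^{-λ̄t})/t)^{η/(1+η)}`. -/
theorem stmt14 {d : ℕ}
    (l : EuclideanSpace ℝ (Fin d) → ℝ)
    (k : Kernel (EuclideanSpace ℝ (Fin d)) (EuclideanSpace ℝ (Fin d))) [IsMarkovKernel k]
    (hl : Measurable l) (hl0 : ∀ x, 0 ≤ l x)
    (lbar : ℝ) (hlbar : ∀ x, l x ≤ lbar)
    (hnofake : ∀ x, ENNReal.ofReal (l x) * k x {x} = 0)
    (P0 : Measure (EuclideanSpace ℝ (Fin d))) [IsProbabilityMeasure P0] :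
    (∀ (n : ℕ) (t : ℝ), 0 ≤ t →
      (ENNReal.ofReal (Real.exp (-lbar * t) * t ^ n / n.factorial)) • jumpQ l k P0 n
          ≤ jumpMarginalN l k P0 n t ∧
        jumpMarginalN l k P0 n t
          ≤ (ENNReal.ofReal (t ^ n / n.factorial)) • jumpQ l k P0 n) ∧
    (∀ (f : EuclideanSpace ℝ (Fin d) → ℝ), Measurable f → ∀ (t : ℝ), 0 < t →
      ∀ (η : ℝ), 0 < η →
      ∫⁻ x, ENNReal.ofReal (l x) * ∫⁻ y, ENNReal.ofReal |f y| ∂(k x)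
          ∂(jumpMarginal l k P0 t)
        ≤ ENNReal.ofReal (Real.exp (lbar * t) *
              ((Real.exp (lbar * t * (Real.exp ((1 + η) / (Real.exp 1 * η)) - 1))
                  - Real.exp (-(lbar * t))) / t) ^ (η / (1 + η))) *
            ((∑' n : ℕ, ∫⁻ x, ENNReal.ofReal (|f x| ^ (1 + η))
                ∂(jumpMarginalN l k P0 (n + 1) t)) / ENNReal.ofReal t) ^ (1 / (1 + η))) := by
  refine ⟨fun n t ht => ⟨le_jumpMarginalN hl hlbar n ht, jumpMarginalN_le hl hl0 n ht⟩,
    fun f hf t ht η hη => ?_⟩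
  have hlbar0 : 0 ≤ lbar := (hl0 0).trans (hlbar 0)
  have hpq : (1 + η).HolderConjugate ((1 + η) / η) := by
    have h := Real.HolderConjugate.conjExponent (p := 1 + η) (by linarith)
    rwa [Real.conjExponent, add_sub_cancel_left] at h
  have hg : Measurable fun x => ENNReal.ofReal |f x| := by fun_prop
  have hgp (x) : ENNReal.ofReal |f x| ^ (1 + η) = ENNReal.ofReal (|f x| ^ (1 + η)) :=
    ENNReal.ofReal_rpow_of_nonneg (abs_nonneg _) (by positivity)
  set D := Real.exp (lbar * t * (Real.exp ((1 + η) / (Real.exp 1 * η)) - 1))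
    - Real.exp (-(lbar * t)) with hD
  have hD0 : 0 ≤ D := by
    have : 1 ≤ Real.exp ((1 + η) / (Real.exp 1 * η)) := Real.one_le_exp (by positivity)
    rw [hD, sub_nonneg, Real.exp_le_exp]
    nlinarith [mul_nonneg hlbar0 ht.le]
  have hexp : Real.exp (lbar * t * Real.exp ((1 + η) / η / Real.exp 1)) - 1
      = Real.exp (lbar * t) * D := by
    rw [hD, mul_sub, ← Real.exp_add, ← Real.exp_add, add_neg_cancel, Real.exp_zero,
      div_div, mul_comm η]
    ring_nf
  have hweight (n : ℕ) : ENNReal.ofReal (t ^ n / n.factorial)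
      = (ENNReal.ofReal t)⁻¹ * (((n + 1 : ℕ) : ℝ≥0∞) *
          ENNReal.ofReal (t ^ (n + 1) / (n + 1).factorial)) := by
    rw [← ENNReal.ofReal_natCast, ← ENNReal.ofReal_inv_of_pos ht,
      ← ENNReal.ofReal_mul (by positivity), ← ENNReal.ofReal_mul (by positivity),
      Nat.factorial_succ]
    congr 1
    push_cast
    field_simp
    ring
  set S := ∑' n : ℕ, ∫⁻ x, ENNReal.ofReal (|f x| ^ (1 + η)) ∂(jumpMarginalN l k P0 (n + 1) t)
  have hconj : 1 / ((1 + η) / η) = η / (1 + η) := one_div_div _ _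
  calc ∫⁻ x, ENNReal.ofReal (l x) * ∫⁻ y, ENNReal.ofReal |f y| ∂(k x) ∂(jumpMarginal l k P0 t)
      ≤ ∑' n : ℕ, ENNReal.ofReal (t ^ n / n.factorial) *
          ∫⁻ y, ENNReal.ofReal |f y| ∂(jumpQ l k P0 (n + 1)) :=
        lintegral_jumpMarginal_le hl hl0 ht.le hg
    _ = (ENNReal.ofReal t)⁻¹ * ∑' n : ℕ, ((n + 1 : ℕ) : ℝ≥0∞) * ∫⁻ y, ENNReal.ofReal |f y|
          ∂(ENNReal.ofReal (t ^ (n + 1) / (n + 1).factorial) • jumpQ l k P0 (n + 1)) := by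
        rw [← ENNReal.tsum_mul_left]
        refine tsum_congr fun n => ?_
        rw [hweight, lintegral_smul_measure, smul_eq_mul]
        ring
    _ ≤ (ENNReal.ofReal t)⁻¹ * ((ENNReal.ofReal (Real.exp (lbar * t)) * S) ^ (1 / (1 + η)) *
          (ENNReal.ofReal (Real.exp (lbar * t)) * ENNReal.ofReal D) ^ (η / (1 + η))) := by
        refine mul_le_mul_right ((tsum_mul_lintegral_le_Lp_mul_Lq _ hpq _ hg).trans ?_) _
        rw [hconj, ← ENNReal.ofReal_mul (Real.exp_nonneg _), ← hexp]
        simp_rw [hgp]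
        gcongr
        · exact tsum_lintegral_jumpQ_rpow_le hl hlbar ht.le _
        · exact tsum_rpow_mul_jumpQ_univ_le hl hlbar0 hlbar ht.le (by positivity)
    _ = _ := by
        rw [inv_mul_rpow_mul_rpow _ _ _ _ (by positivity) (by positivity) (by field_simp),
          ENNReal.ofReal_mul (Real.exp_nonneg _), ← ENNReal.ofReal_div_of_pos ht,
          ENNReal.ofReal_rpow_of_nonneg (by positivity) (by positivity)]
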